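/- Let W be a d×n real matrix with nonnegative entries, x ∈ ℝ^d with nonnegative entries, λ > 0, τ > 0, and let {g_1, …, g_B} be a partition of {1, …, n} into disjoint blocks. Define L(h) = ‖x − Wh‖₂² + λ·Σ_{b=1}^B log(τ + Σ_{i ∈ g_b} h_i) on the nonnegative orthant. Let h̄ ∈ ℝ^n have strictly positive entries, suppose each denominator (WᵀWh̄)_i + λ/(2(τ + Σ_{k ∈ g_{b(i)}} h̄_k)) is strictly positive (where b(i) denotes the index of the block containing i), and define the block reweighted ℓ₁ multiplicative update h⁺_i = h̄_i·(Wᵀx)_i / ((WᵀWh̄)_i + λ/(2(τ + Σ_{k ∈ g_{b(i)}} h̄_k))). Then every entry of h⁺ is nonnegative and L(h⁺) ≤ L(h̄). -/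

import Mathlib

open Matrix BigOperators

/-- Lee–Seung bound: for entrywise nonnegative `W` and positive `h`, the matrix `Wᵀ * W` is
dominated by the diagonal matrix with entries `((Wᵀ * W) h)ⱼ / hⱼ`. -/
lemma sum_sq_mulVec_le {m n : Type*} [Fintype m] [Fintype n] (W : Matrix m n ℝ)
    (hW : ∀ i j, 0 ≤ W i j) (h : n → ℝ) (hpos : ∀ j, 0 < h j) (δ : n → ℝ) :
    ∑ i, (W *ᵥ δ) i ^ 2 ≤ ∑ j, ((Wᵀ * W) *ᵥ h) j * (δ j ^ 2 / h j) := by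
  have hrow (i : m) : (W *ᵥ δ) i ^ 2 ≤ (W *ᵥ h) i * ∑ j, W i j * (δ j ^ 2 / h j) := by
    refine Finset.sum_sq_le_sum_mul_sum_of_sq_le_mul _ (fun j _ => ?_) (fun j _ => ?_)
      (fun j _ => ?_)
    · exact mul_nonneg (hW i j) (hpos j).le
    · exact mul_nonneg (hW i j) (div_nonneg (sq_nonneg _) (hpos j).le)
    · have := (hpos j).ne'
      refine le_of_eq ?_
      field_simp
  refine (Finset.sum_le_sum fun i _ => hrow i).trans_eq ?_
  simp only [← Matrix.mulVec_mulVec, Finset.mul_sum]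
  rw [Finset.sum_comm]
  refine Finset.sum_congr rfl fun j _ => ?_
  rw [Matrix.mulVec, dotProduct, Finset.sum_mul]
  exact Finset.sum_congr rfl fun i _ => by rw [Matrix.transpose_apply]; ring

lemma sum_sq_sub_mulVec_add {m n : Type*} [Fintype m] [Fintype n] (W : Matrix m n ℝ)
    (x : m → ℝ) (h δ : n → ℝ) :
    ∑ i, (x i - (W *ᵥ (h + δ)) i) ^ 2 = ∑ i, (x i - (W *ᵥ h) i) ^ 2
      - 2 * ∑ j, δ j * ((Wᵀ *ᵥ x) j - ((Wᵀ * W) *ᵥ h) j) + ∑ i, (W *ᵥ δ) i ^ 2 := by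
  have hcross : ∑ j, δ j * ((Wᵀ *ᵥ x) j - ((Wᵀ * W) *ᵥ h) j)
      = ∑ i, (x i - (W *ᵥ h) i) * (W *ᵥ δ) i := by
    calc _ = δ ⬝ᵥ (Wᵀ *ᵥ (x - W *ᵥ h)) := by
          rw [Matrix.mulVec_sub, Matrix.mulVec_mulVec]; rfl
      _ = (x - W *ᵥ h) ⬝ᵥ (W *ᵥ δ) := by
          rw [Matrix.mulVec_transpose, dotProduct_comm, Matrix.dotProduct_mulVec]
  rw [hcross, Finset.mul_sum, ← Finset.sum_sub_distrib, ← Finset.sum_add_distrib]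
  refine Finset.sum_congr rfl fun i _ => ?_
  rw [Matrix.mulVec_add, Pi.add_apply]
  ring

lemma Real.log_le_log_add_div {s t : ℝ} (hs : 0 < s) (ht : 0 < t) :
    Real.log t ≤ Real.log s + (t - s) / s := by
  have := Real.log_le_sub_one_of_pos (div_pos ht hs)
  rw [Real.log_div ht.ne' hs.ne'] at this
  rw [sub_div, div_self hs.ne']
  linarith

/-- Tangent-line majorization of the block diversity measure. -/
lemma sum_log_block_le {ι β : Type*} [Fintype ι] [Fintype β] [DecidableEq β] (blk : ι → β)
    {τ : ℝ} (hτ : 0 < τ) {h h' : ι → ℝ} (hh : ∀ i, 0 ≤ h i) (hh' : ∀ i, 0 ≤ h' i) :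
    ∑ b, Real.log (τ + ∑ k ∈ Finset.univ.filter (fun k => blk k = b), h' k) ≤
      ∑ b, Real.log (τ + ∑ k ∈ Finset.univ.filter (fun k => blk k = b), h k) +
        ∑ i, (h' i - h i) / (τ + ∑ k ∈ Finset.univ.filter (fun k => blk k = blk i), h k) := by
  rw [← Finset.sum_fiberwise Finset.univ blk
    (fun i => (h' i - h i) / (τ + ∑ k ∈ Finset.univ.filter (fun k => blk k = blk i), h k)),
    ← Finset.sum_add_distrib]
  refine Finset.sum_le_sum fun b _ => ?_
  have hblock : ∑ i ∈ Finset.univ.filter (fun k => blk k = b),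
      (h' i - h i) / (τ + ∑ k ∈ Finset.univ.filter (fun k => blk k = blk i), h k) =
      ((τ + ∑ k ∈ Finset.univ.filter (fun k => blk k = b), h' k) -
        (τ + ∑ k ∈ Finset.univ.filter (fun k => blk k = b), h k)) /
        (τ + ∑ k ∈ Finset.univ.filter (fun k => blk k = b), h k) := by
    rw [add_sub_add_left_eq_sub, ← Finset.sum_sub_distrib, Finset.sum_div]
    refine Finset.sum_congr rfl fun i hi => ?_
    rw [(Finset.mem_filter.mp hi).2]
  rw [hblock]
  exact Real.log_le_log_add_div
    (add_pos_of_pos_of_nonneg hτ (Finset.sum_nonneg fun i _ => hh i))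
    (add_pos_of_pos_of_nonneg hτ (Finset.sum_nonneg fun i _ => hh' i))

/-- The block reweighted ℓ₁ multiplicative update preserves non-negativity and does
not increase the block-sparse S-NNLS objective (block rectified generalized double
Pareto prior). The partition of `{1,…,n}` into `B` disjoint blocks is encoded by the
block assignment map `blk`, with block `g_b = blk ⁻¹ {b}`. -/
theorem stmt_18 (d n B : ℕ)
    (W : Matrix (Fin d) (Fin n) ℝ) (hW : ∀ i j, 0 ≤ W i j)
    (x : Fin d → ℝ) (hx : ∀ i, 0 ≤ x i)
    (lam τ : ℝ) (hlam : 0 < lam) (hτ : 0 < τ)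
    (blk : Fin n → Fin B)
    (L : (Fin n → ℝ) → ℝ)
    (hL : ∀ h, L h = ∑ i, (x i - W.mulVec h i) ^ 2 +
      lam * ∑ b : Fin B,
        Real.log (τ + ∑ k ∈ Finset.univ.filter (fun k => blk k = b), h k))
    (hbar : Fin n → ℝ) (hpos : ∀ i, 0 < hbar i)
    (hden : ∀ i, 0 < (Wᵀ * W).mulVec hbar i +
      lam / (2 * (τ + ∑ k ∈ Finset.univ.filter (fun k => blk k = blk i), hbar k)))
    (hplus : Fin n → ℝ)
    (hplusdef : ∀ i, hplus i =
      hbar i * Wᵀ.mulVec x i /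
        ((Wᵀ * W).mulVec hbar i +
          lam / (2 * (τ + ∑ k ∈ Finset.univ.filter (fun k => blk k = blk i), hbar k)))) :
    (∀ i, 0 ≤ hplus i) ∧ L hplus ≤ L hbar := by
  have hnonneg (i : Fin n) : 0 ≤ hplus i := by
    have hv : 0 ≤ (Wᵀ *ᵥ x) i := by
      rw [Matrix.mulVec, dotProduct]
      exact Finset.sum_nonneg fun j _ => mul_nonneg (hW j i) (hx j)
    rw [hplusdef i]
    exact div_nonneg (mul_nonneg (hpos i).le hv) (hden i).le
  refine ⟨hnonneg, ?_⟩
  set S : Fin n → ℝ :=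
    fun i => τ + ∑ k ∈ Finset.univ.filter (fun k => blk k = blk i), hbar k
  have hSpos (i : Fin n) : 0 < S i :=
    add_pos_of_pos_of_nonneg hτ (Finset.sum_nonneg fun k _ => (hpos k).le)
  have hquad := sum_sq_sub_mulVec_add W x hbar (hplus - hbar)
  rw [add_sub_cancel] at hquad
  have hmaj := sum_sq_mulVec_le W hW hbar hpos (hplus - hbar)
  have hlog := mul_le_mul_of_nonneg_left
    (sum_log_block_le blk hτ (fun i => (hpos i).le) hnonneg) hlam.le
  have hsurrogate : ∑ j, ((Wᵀ * W) *ᵥ hbar) j * ((hplus - hbar) j ^ 2 / hbar j)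
      - 2 * ∑ j, (hplus - hbar) j * ((Wᵀ *ᵥ x) j - ((Wᵀ * W) *ᵥ hbar) j)
      + lam * ∑ i, (hplus i - hbar i) / S i ≤ 0 := by
    rw [Finset.mul_sum, Finset.mul_sum, ← Finset.sum_sub_distrib, ← Finset.sum_add_distrib]
    refine Finset.sum_nonpos fun i _ => ?_
    have hv : (Wᵀ *ᵥ x) i =
        hplus i * (((Wᵀ * W) *ᵥ hbar) i + lam / (2 * S i)) / hbar i := by
      have h1 := (hden i).ne'
      have h2 := (hpos i).ne'
      rw [hplusdef i, div_mul_cancel₀ _ h1, mul_div_cancel_left₀ _ h2]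
    have hD := hden i
    have hc : 0 < lam / (2 * S i) := div_pos hlam (mul_pos two_pos (hSpos i))
    have hq : 0 ≤ (hplus i - hbar i) ^ 2 / hbar i := div_nonneg (sq_nonneg _) (hpos i).le
    have key : ((Wᵀ * W) *ᵥ hbar) i * ((hplus - hbar) i ^ 2 / hbar i)
        - 2 * ((hplus - hbar) i * ((Wᵀ *ᵥ x) i - ((Wᵀ * W) *ᵥ hbar) i))
        + lam * ((hplus i - hbar i) / S i) =
        -((((Wᵀ * W) *ᵥ hbar) i + lam / (2 * S i)) * ((hplus i - hbar i) ^ 2 / hbar i))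
          - lam / (2 * S i) * ((hplus i - hbar i) ^ 2 / hbar i) := by
      have h2 := (hpos i).ne'
      have h3 := (hSpos i).ne'
      rw [hv, Pi.sub_apply]
      generalize S i = s at *
      field_simp
      ring
    rw [key]
    have := mul_nonneg hD.le hq
    have := mul_nonneg hc.le hq
    linarith
  rw [hL, hL]
  rw [mul_add] at hlog
  linarith
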